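/- Let n ≥ 1, 0 < θ ≤ 1 and let u : ℝⁿ → ℝ be C¹ on ℝⁿ and C³ on {|∇u| > 0}, satisfying div(∇u/√(1+|∇u|²)) = log^{θ}(1 + |∇u|²) on all of ℝⁿ. If u(x) = o(|x|²) as |x| → ∞ (i.e. |u(x)|/|x|² → 0 as |x| → ∞), then u is constant. -/

import Mathlib

open Metric Real Filter

noncomputable def pd1 {n : ℕ} (u : EuclideanSpace ℝ (Fin n) → ℝ) (i : Fin n)
    (x : EuclideanSpace ℝ (Fin n)) : ℝ :=
  fderiv ℝ u x (EuclideanSpace.single i 1)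

noncomputable def pd2 {n : ℕ} (u : EuclideanSpace ℝ (Fin n) → ℝ) (i j : Fin n)
    (x : EuclideanSpace ℝ (Fin n)) : ℝ :=
  fderiv ℝ (pd1 u j) x (EuclideanSpace.single i 1)

/-- The coefficients `a^{ij} = δ^{ij} - u_i u_j / (1 + |∇u|²)` of the
nondivergence form of the mean curvature operator. -/
noncomputable def aCoef {n : ℕ} (u : EuclideanSpace ℝ (Fin n) → ℝ) (i j : Fin n)
    (x : EuclideanSpace ℝ (Fin n)) : ℝ :=
  (if i = j then (1 : ℝ) else 0) - pd1 u i x * pd1 u j x / (1 + ‖gradient u x‖ ^ 2)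

/-- The mean curvature operator in nondivergence form: `a^{ij} u_{ij}`. -/
noncomputable def mcOp {n : ℕ} (u : EuclideanSpace ℝ (Fin n) → ℝ)
    (x : EuclideanSpace ℝ (Fin n)) : ℝ :=
  ∑ i, ∑ j, aCoef u i j x * pd2 u i j x

/-- Second derivative test at an interior maximum. -/
lemma second_deriv_nonpos_of_isLocalMax {f f' : ℝ → ℝ} {c : ℝ}
    (hf : ∀ᶠ t in nhds 0, HasDerivAt f (f' t) t) (hf' : HasDerivAt f' c 0)
    (hmax : IsLocalMax f 0) : c ≤ 0 := by
  by_contra! hc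
  have hd : deriv f =ᶠ[nhds 0] f' := hf.mono fun t ht => ht.deriv
  have h0 : HasDerivAt f (f' 0) 0 := hf.self_of_nhds
  have hdd : deriv (deriv f) 0 = c := by rw [hd.deriv_eq, hf'.deriv]
  have hmin : IsLocalMin f 0 :=
    isLocalMin_of_deriv_deriv_pos (by rw [hdd]; exact hc)
      (by rw [h0.deriv]; exact hmax.hasDerivAt_eq_zero h0) h0.continuousAt
  have hconst : f =ᶠ[nhds 0] fun _ => f 0 := by
    filter_upwards [hmax, hmin] with t h1 h2 using le_antisymm h1 h2
  have h1 : deriv f =ᶠ[nhds 0] fun _ => 0 := by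
    have := hconst.deriv
    simpa using this
  have : deriv (deriv f) 0 = 0 := by rw [h1.deriv_eq]; simp
  linarith

/-- First and second order conditions at a local maximum of `log log (1 + q) - κ a + log s`. -/
lemma order_conditions_of_isLocalMax {q q' a a' s s' : ℝ → ℝ} {q'' a'' s'' κ : ℝ}
    (hq : ∀ᶠ t in nhds 0, HasDerivAt q (q' t) t) (hq' : HasDerivAt q' q'' 0)
    (ha : ∀ᶠ t in nhds 0, HasDerivAt a (a' t) t) (ha' : HasDerivAt a' a'' 0)
    (hs : ∀ᶠ t in nhds 0, HasDerivAt s (s' t) t) (hs' : HasDerivAt s' s'' 0)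
    (hq0 : 0 < q 0) (hs0 : 0 < s 0)
    (hmax : IsLocalMax (fun t => log (log (1 + q t)) - κ * a t + log (s t)) 0) :
    q' 0 / ((1 + q 0) * log (1 + q 0)) - κ * a' 0 + s' 0 / s 0 = 0 ∧
    (q'' / (1 + q 0) - (q' 0) ^ 2 / (1 + q 0) ^ 2) / log (1 + q 0)
      - (q' 0 / ((1 + q 0) * log (1 + q 0))) ^ 2 - κ * a'' + s'' / s 0 - (s' 0 / s 0) ^ 2
      ≤ 0 := by
  have hqc : ∀ᶠ t in nhds 0, 0 < q t :=
    hq.self_of_nhds.continuousAt.eventually (lt_mem_nhds hq0)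
  have hsc : ∀ᶠ t in nhds 0, 0 < s t :=
    hs.self_of_nhds.continuousAt.eventually (lt_mem_nhds hs0)
  have hlog : ∀ {t : ℝ}, 0 < t → 0 < log (1 + t) := fun ht => log_pos (by linarith)
  have hd : ∀ᶠ t in nhds 0, HasDerivAt (fun t => log (log (1 + q t)) - κ * a t + log (s t))
      (q' t / (1 + q t) / log (1 + q t) - κ * a' t + s' t / s t) t := by
    filter_upwards [hqc, hsc, hq, ha, hs] with t h1 h2 h3 h4 h5
    exact ((((h3.const_add 1).log (by positivity)).log (hlog h1).ne').sub
      (h4.const_mul κ)).add (h5.log h2.ne')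
  have hl0 := hlog hq0
  have hd2 := (((hq'.div (hq.self_of_nhds.const_add 1) (by positivity)).div
    ((hq.self_of_nhds.const_add 1).log (by positivity)) hl0.ne').sub (ha'.const_mul κ)).add
    (hs'.div hs.self_of_nhds hs0.ne')
  have h1 := hmax.hasDerivAt_eq_zero hd.self_of_nhds
  have h2 := second_deriv_nonpos_of_isLocalMax hd hd2 hmax
  constructor
  · simpa only [div_div] using h1
  · refine le_of_eq_of_le ?_ h2
    simp only [Pi.div_apply]
    have : 1 + q 0 ≠ 0 := by positivity
    have := hs0.ne'
    have := hl0.ne'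
    field_simp
    ring

lemma sum_coord_smul_single {n : ℕ} (P : EuclideanSpace ℝ (Fin n)) :
    ∑ k, P k • EuclideanSpace.single k (1 : ℝ) = P := by
  simpa using (EuclideanSpace.basisFun (Fin n) ℝ).sum_repr P

/-- The vectors `e_k - P_k P / (W (1 + W))`, `W = √(1 + |P|²)`, form the rows of the square root
of the matrix `I - P Pᵀ / (1 + |P|²)`. -/
noncomputable def frame {n : ℕ} (P : EuclideanSpace ℝ (Fin n)) (k : Fin n) :
    EuclideanSpace ℝ (Fin n) :=
  EuclideanSpace.single k 1 - (P k / (√(1 + ‖P‖ ^ 2) * (1 + √(1 + ‖P‖ ^ 2)))) • P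

lemma sum_frame {n : ℕ} (β : EuclideanSpace ℝ (Fin n) →L[ℝ] EuclideanSpace ℝ (Fin n) →L[ℝ] ℝ)
    (P : EuclideanSpace ℝ (Fin n)) :
    ∑ k, β (frame P k) (frame P k) =
      ∑ k, β (EuclideanSpace.single k 1) (EuclideanSpace.single k 1)
        - β P P / (1 + ‖P‖ ^ 2) := by
  have hW : (√(1 + ‖P‖ ^ 2)) ^ 2 = 1 + ‖P‖ ^ 2 := sq_sqrt (by positivity)
  have hWpos : 0 < √(1 + ‖P‖ ^ 2) := sqrt_pos.2 (by positivity)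
  have h1 : ∑ k, P k * β (EuclideanSpace.single k 1) P = β P P := by
    simpa [-EuclideanSpace.basisFun_apply] using
      congrArg (fun x => β x P) (sum_coord_smul_single P)
  have h2 : ∑ k, P k * β P (EuclideanSpace.single k 1) = β P P := by
    simpa using congrArg (fun x => β P x) (sum_coord_smul_single P)
  have h3 : ∑ k, P k ^ 2 = ‖P‖ ^ 2 := by simp [EuclideanSpace.norm_sq_eq]
  unfold frame
  set W := √(1 + ‖P‖ ^ 2) with hWdef
  set c := 1 / (W * (1 + W)) with hc
  have hexp : ∀ k, β (EuclideanSpace.single k 1 - (P k / (W * (1 + W))) • P)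
      (EuclideanSpace.single k 1 - (P k / (W * (1 + W))) • P) =
      β (EuclideanSpace.single k 1) (EuclideanSpace.single k 1)
        - c * (P k * β (EuclideanSpace.single k 1) P)
        - c * (P k * β P (EuclideanSpace.single k 1)) + c ^ 2 * β P P * P k ^ 2 := by
    intro k
    have : P k / (W * (1 + W)) = c * P k := by rw [hc]; ring
    rw [this]
    simp only [map_sub, map_smul, sub_apply, smul_apply,
      smul_eq_mul]
    ring
  rw [Finset.sum_congr rfl fun k _ => hexp k, Finset.sum_add_distrib, Finset.sum_sub_distrib,
    Finset.sum_sub_distrib, ← Finset.mul_sum, ← Finset.mul_sum, ← Finset.mul_sum, h1, h2, h3,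
    ← hW]
  have hq : ‖P‖ ^ 2 = W ^ 2 - 1 := by linarith
  rw [hq, hc]
  field_simp
  ring

lemma sum_frame_mul {n : ℕ} (l : EuclideanSpace ℝ (Fin n) →L[ℝ] ℝ)
    (P : EuclideanSpace ℝ (Fin n)) :
    ∑ k, (l (frame P k)) ^ 2 =
      ∑ k, (l (EuclideanSpace.single k 1)) ^ 2 - (l P) ^ 2 / (1 + ‖P‖ ^ 2) := by
  have := sum_frame (l.smulRight l) P
  simpa [sq] using this

lemma sum_frame_norm_sq_le {n : ℕ} (P : EuclideanSpace ℝ (Fin n)) :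
    ∑ k, ‖frame P k‖ ^ 2 ≤ n := by
  have : ∑ k, inner ℝ (frame P k) (frame P k) =
      ∑ k : Fin n, inner ℝ (EuclideanSpace.single k (1 : ℝ)) (EuclideanSpace.single k (1 : ℝ))
        - inner ℝ P P / (1 + ‖P‖ ^ 2) := sum_frame (innerSL ℝ) P
  simp only [real_inner_self_eq_norm_sq] at this
  rw [this]
  have : 0 ≤ ‖P‖ ^ 2 / (1 + ‖P‖ ^ 2) := by positivity
  simp
  linarith

/-- Cauchy-Schwarz for the trace of a bilinear form over the frame. -/
lemma sq_sum_frame_le {n : ℕ}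
    (U : EuclideanSpace ℝ (Fin n) →L[ℝ] EuclideanSpace ℝ (Fin n) →L[ℝ] ℝ)
    (P : EuclideanSpace ℝ (Fin n)) :
    (∑ k, U (frame P k) (frame P k)) ^ 2 ≤
      (∑ k, ∑ i, (U (frame P k) (EuclideanSpace.single i 1)) ^ 2) * n := by
  have h1 : ∀ k, U (frame P k) (frame P k) =
      ∑ i, U (frame P k) (EuclideanSpace.single i 1) * frame P k i := by
    intro k
    conv_lhs => arg 2; rw [← sum_coord_smul_single (frame P k)]
    simp [mul_comm]
  have h2 := Finset.sum_mul_sq_le_sq_mul_sq (Finset.univ : Finset (Fin n × Fin n))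
    (fun x => U (frame P x.1) (EuclideanSpace.single x.2 1)) (fun x => frame P x.1 x.2)
  rw [Fintype.sum_prod_type, Fintype.sum_prod_type, Fintype.sum_prod_type] at h2
  simp_rw [h1]
  refine h2.trans ?_
  refine mul_le_mul_of_nonneg_left ?_ (by positivity)
  refine le_of_eq_of_le ?_ (sum_frame_norm_sq_le P)
  simp [EuclideanSpace.norm_sq_eq]

/-- The Bernstein inequality at a critical point, in terms of the jet of the solution:
`P`, `U`, `T` are the first, second and third derivatives, `D` is the derivative of the cutoff. -/
lemma bernstein_jet {n : ℕ} (P : EuclideanSpace ℝ (Fin n))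
    (U : EuclideanSpace ℝ (Fin n) →L[ℝ] EuclideanSpace ℝ (Fin n) →L[ℝ] ℝ)
    (T : EuclideanSpace ℝ (Fin n) →L[ℝ] EuclideanSpace ℝ (Fin n) →L[ℝ]
      EuclideanSpace ℝ (Fin n) →L[ℝ] ℝ)
    (D : EuclideanSpace ℝ (Fin n) →L[ℝ] ℝ) {B B' L κ s R : ℝ} (hL : 0 < L) (hs : 0 < s)
    (hR : 0 < R)
    (hU : ∀ v w, U v w = U w v) (hT : ∀ v, T v v P = T P v v)
    (hE : ∑ k, U (EuclideanSpace.single k 1) (EuclideanSpace.single k 1)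
      - U P P / (1 + ‖P‖ ^ 2) = B)
    (hE' : ∑ k, T P (EuclideanSpace.single k 1) (EuclideanSpace.single k 1)
      - T P P P / (1 + ‖P‖ ^ 2) - 2 * ∑ i, (U P (EuclideanSpace.single i 1)) ^ 2 / (1 + ‖P‖ ^ 2)
      + 2 * (U P P) ^ 2 / (1 + ‖P‖ ^ 2) ^ 2 = B' * (2 * U P P))
    (h1 : ∀ v, 2 * U v P / ((1 + ‖P‖ ^ 2) * L) - κ * inner ℝ P v + D v / s = 0)
    (h2 : ∀ v, ((2 * ∑ i, (U v (EuclideanSpace.single i 1)) ^ 2 + 2 * T v v P) / (1 + ‖P‖ ^ 2)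
      - (2 * U v P) ^ 2 / (1 + ‖P‖ ^ 2) ^ 2) / L - (2 * U v P / ((1 + ‖P‖ ^ 2) * L)) ^ 2
      - κ * U v v + (-2 * ‖v‖ ^ 2 / R ^ 2) / s - (D v / s) ^ 2 ≤ 0)
    (hD : ∑ i, (D (EuclideanSpace.single i 1)) ^ 2 ≤ 4 / R ^ 2) :
    2 * B ^ 2 / (n * (1 + ‖P‖ ^ 2) * L) + 2 * B' * (κ * ‖P‖ ^ 2 - D P / s) - κ * B ≤
      2 * n / (R ^ 2 * s) + 12 / (R ^ 2 * s ^ 2) + 2 * κ ^ 2 := by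
  have hsum := Finset.sum_nonpos fun k (_ : k ∈ Finset.univ) => h2 (frame P k)
  have hq : 0 < 1 + ‖P‖ ^ 2 := by positivity
  set S := ∑ k, ∑ i, (U (frame P k) (EuclideanSpace.single i 1)) ^ 2 with hS
  have hTs : ∑ k, T (frame P k) (frame P k) P =
      ∑ k, T P (EuclideanSpace.single k 1) (EuclideanSpace.single k 1)
      - T P P P / (1 + ‖P‖ ^ 2) := by
    rw [← sum_frame (T P) P]
    exact Finset.sum_congr rfl fun k _ => hT _
  have hUs : ∑ k, U (frame P k) (frame P k) = B := by rw [sum_frame, hE]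
  have hUPs : ∑ k, (U (frame P k) P) ^ 2 = ∑ i, (U P (EuclideanSpace.single i 1)) ^ 2
      - (U P P) ^ 2 / (1 + ‖P‖ ^ 2) := by
    rw [← sum_frame_mul (U P) P]
    exact Finset.sum_congr rfl fun k _ => by rw [hU]
  have hDs : ∑ k, (D (frame P k)) ^ 2 ≤ 4 / R ^ 2 := by
    rw [sum_frame_mul]
    have : 0 ≤ (D P) ^ 2 / (1 + ‖P‖ ^ 2) := by positivity
    linarith
  have hPs : ∑ k, (inner ℝ P (frame P k)) ^ 2 ≤ 1 := by
    have := sum_frame_mul (innerSL ℝ P) P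
    simp only [innerSL_apply_apply, real_inner_self_eq_norm_sq] at this
    rw [this]
    have h3 : ∑ k, (inner ℝ P (EuclideanSpace.single k (1 : ℝ))) ^ 2 = ‖P‖ ^ 2 := by
      simp [EuclideanSpace.norm_sq_eq, EuclideanSpace.inner_single_right]
    rw [h3]
    have : ‖P‖ ^ 2 - (‖P‖ ^ 2) ^ 2 / (1 + ‖P‖ ^ 2) = ‖P‖ ^ 2 / (1 + ‖P‖ ^ 2) := by
      field_simp; ring
    rw [this, div_le_one hq]
    linarith
  have hNs := sum_frame_norm_sq_le P
  have hCS : B ^ 2 ≤ S * n := by rw [← hUs]; exact sq_sum_frame_le U P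
  have hgrad : ∑ k, (2 * U (frame P k) P / ((1 + ‖P‖ ^ 2) * L)) ^ 2 ≤
      2 * κ ^ 2 + 8 / (R ^ 2 * s ^ 2) := by
    have hle : ∀ k, (2 * U (frame P k) P / ((1 + ‖P‖ ^ 2) * L)) ^ 2 ≤
        2 * κ ^ 2 * (inner ℝ P (frame P k)) ^ 2 + 2 / s ^ 2 * (D (frame P k)) ^ 2 := by
      intro k
      have : 2 * U (frame P k) P / ((1 + ‖P‖ ^ 2) * L) =
        κ * inner ℝ P (frame P k) - D (frame P k) / s := by linarith [h1 (frame P k)]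
      rw [this]
      have : 2 / s ^ 2 * (D (frame P k)) ^ 2 = 2 * (D (frame P k) / s) ^ 2 := by
        field_simp
      rw [this]
      nlinarith [sq_nonneg (κ * inner ℝ P (frame P k) + D (frame P k) / s)]
    refine (Finset.sum_le_sum fun k _ => hle k).trans ?_
    rw [Finset.sum_add_distrib, ← Finset.mul_sum, ← Finset.mul_sum]
    have e1 : 2 * κ ^ 2 * ∑ k, (inner ℝ P (frame P k)) ^ 2 ≤ 2 * κ ^ 2 * 1 := by gcongr
    have e2 : 2 / s ^ 2 * ∑ k, (D (frame P k)) ^ 2 ≤ 2 / s ^ 2 * (4 / R ^ 2) := by gcongr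
    have e3 : 2 / s ^ 2 * (4 / R ^ 2) = 8 / (R ^ 2 * s ^ 2) := by field_simp; norm_num
    linarith
  have hsplit : ∀ k, ((2 * ∑ i, (U (frame P k) (EuclideanSpace.single i 1)) ^ 2
      + 2 * T (frame P k) (frame P k) P) / (1 + ‖P‖ ^ 2)
      - (2 * U (frame P k) P) ^ 2 / (1 + ‖P‖ ^ 2) ^ 2) / L
      - (2 * U (frame P k) P / ((1 + ‖P‖ ^ 2) * L)) ^ 2
      - κ * U (frame P k) (frame P k) + (-2 * ‖frame P k‖ ^ 2 / R ^ 2) / s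
      - (D (frame P k) / s) ^ 2 =
      2 / ((1 + ‖P‖ ^ 2) * L) * (∑ i, (U (frame P k) (EuclideanSpace.single i 1)) ^ 2)
      + 2 / ((1 + ‖P‖ ^ 2) * L) * T (frame P k) (frame P k) P
      - 4 / ((1 + ‖P‖ ^ 2) ^ 2 * L) * (U (frame P k) P) ^ 2
      - (2 * U (frame P k) P / ((1 + ‖P‖ ^ 2) * L)) ^ 2
      - κ * U (frame P k) (frame P k) - 2 / (R ^ 2 * s) * ‖frame P k‖ ^ 2
      - 1 / s ^ 2 * (D (frame P k)) ^ 2 := by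
    intro k
    generalize U (frame P k) P = x
    generalize ∑ i, (U (frame P k) (EuclideanSpace.single i 1)) ^ 2 = y
    generalize T (frame P k) (frame P k) P = z
    generalize D (frame P k) = d
    generalize U (frame P k) (frame P k) = z'
    generalize 1 + ‖P‖ ^ 2 = Q at hq
    generalize ‖frame P k‖ = N
    clear_value S
    clear * - hq hL hR hs
    field_simp
    ring
  simp_rw [hsplit] at hsum
  simp only [Finset.sum_sub_distrib, Finset.sum_add_distrib, ← Finset.mul_sum] at hsum
  rw [← hS, hTs, hUs, hUPs] at hsum
  set w := ∑ i, (U P (EuclideanSpace.single i 1)) ^ 2 with hw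
  have hE'' : ∑ k, T P (EuclideanSpace.single k 1) (EuclideanSpace.single k 1)
      - T P P P / (1 + ‖P‖ ^ 2) = 2 * w / (1 + ‖P‖ ^ 2)
        - 2 * (U P P) ^ 2 / (1 + ‖P‖ ^ 2) ^ 2 + B' * (2 * U P P) := by
    rw [← Finset.sum_div, ← mul_div_assoc] at hE'
    linarith
  rw [hE''] at hsum
  have hP := h1 P
  rw [real_inner_self_eq_norm_sq] at hP
  have hkey : 2 / ((1 + ‖P‖ ^ 2) * L) * S
      + 2 / ((1 + ‖P‖ ^ 2) * L) * (2 * w / (1 + ‖P‖ ^ 2)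
        - 2 * (U P P) ^ 2 / (1 + ‖P‖ ^ 2) ^ 2 + B' * (2 * U P P))
      - 4 / ((1 + ‖P‖ ^ 2) ^ 2 * L) * (w - (U P P) ^ 2 / (1 + ‖P‖ ^ 2)) =
      2 / ((1 + ‖P‖ ^ 2) * L) * S + 2 * B' * (κ * ‖P‖ ^ 2 - D P / s) := by
    have : κ * ‖P‖ ^ 2 - D P / s = 2 * U P P / ((1 + ‖P‖ ^ 2) * L) := by linarith
    rw [this]
    generalize U P P = x
    generalize 1 + ‖P‖ ^ 2 = Q at hq
    clear_value S w
    clear * - hq hL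
    field_simp
    ring
  rw [hkey] at hsum
  have f1 : 2 / (R ^ 2 * s) * ∑ k, ‖frame P k‖ ^ 2 ≤ 2 / (R ^ 2 * s) * n := by gcongr
  have f2 : 1 / s ^ 2 * ∑ k, (D (frame P k)) ^ 2 ≤ 1 / s ^ 2 * (4 / R ^ 2) := by gcongr
  have f3 : 2 * B ^ 2 / (n * (1 + ‖P‖ ^ 2) * L) ≤ 2 / ((1 + ‖P‖ ^ 2) * L) * S := by
    have hS0 : 0 ≤ S := Finset.sum_nonneg fun k _ => Finset.sum_nonneg fun i _ => sq_nonneg _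
    clear_value S
    clear * - hS0 hCS hL hq
    rcases Nat.eq_zero_or_pos n with rfl | hn
    · simp only [CharP.cast_eq_zero, zero_mul, div_zero]
      positivity
    · have hn' : (0 : ℝ) < n := by exact_mod_cast hn
      rw [div_le_iff₀ (by positivity)]
      calc 2 * B ^ 2 ≤ 2 * (S * n) := by linarith
        _ = _ := by field_simp
  have f4 : 1 / s ^ 2 * (4 / R ^ 2) = 4 / (R ^ 2 * s ^ 2) := by field_simp
  have f5 : 2 / (R ^ 2 * s) * (n : ℝ) = 2 * n / (R ^ 2 * s) := by ring
  have f6 : 12 / (R ^ 2 * s ^ 2) = 4 / (R ^ 2 * s ^ 2) + 8 / (R ^ 2 * s ^ 2) := by ring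
  linarith
lemma gradient_coord {n : ℕ} (u : EuclideanSpace ℝ (Fin n) → ℝ) (x : EuclideanSpace ℝ (Fin n))
    (i : Fin n) : gradient u x i = fderiv ℝ u x (EuclideanSpace.single i 1) := by
  rw [← inner_gradient_left, EuclideanSpace.inner_single_right]
  simp

lemma norm_gradient_sq {n : ℕ} (u : EuclideanSpace ℝ (Fin n) → ℝ)
    (x : EuclideanSpace ℝ (Fin n)) :
    ‖gradient u x‖ ^ 2 = ∑ i, (fderiv ℝ u x (EuclideanSpace.single i 1)) ^ 2 := by
  simp [EuclideanSpace.norm_sq_eq, gradient_coord]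

lemma mcOp_eq {n : ℕ} {u : EuclideanSpace ℝ (Fin n) → ℝ} {x : EuclideanSpace ℝ (Fin n)}
    (h : DifferentiableAt ℝ (fderiv ℝ u) x) :
    mcOp u x = ∑ k, fderiv ℝ (fderiv ℝ u) x (EuclideanSpace.single k 1) (EuclideanSpace.single k 1)
      - fderiv ℝ (fderiv ℝ u) x (gradient u x) (gradient u x) / (1 + ‖gradient u x‖ ^ 2) := by
  have hpd2 : ∀ i j, pd2 u i j x =
      fderiv ℝ (fderiv ℝ u) x (EuclideanSpace.single i 1) (EuclideanSpace.single j 1) := by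
    intro i j
    have : HasFDerivAt (pd1 u j) _ x :=
      h.hasFDerivAt.clm_apply (hasFDerivAt_const (EuclideanSpace.single j (1 : ℝ)) x)
    rw [pd2, this.fderiv]
    simp
  have hG : fderiv ℝ (fderiv ℝ u) x (gradient u x) (gradient u x) = ∑ i, ∑ j,
      pd1 u i x * pd1 u j x * pd2 u i j x := by
    have h1 : gradient u x = ∑ i, pd1 u i x • EuclideanSpace.single i (1 : ℝ) := by
      conv_lhs => rw [← sum_coord_smul_single (gradient u x)]
      simp_rw [gradient_coord, pd1]
    rw [h1]
    simp only [map_sum, map_smul, sum_apply, smul_apply, smul_eq_mul, hpd2]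
    simp only [Finset.mul_sum]
    rw [Finset.sum_comm]
    exact Finset.sum_congr rfl fun i _ => Finset.sum_congr rfl fun j _ => by ring
  rw [hG, mcOp, Finset.sum_div, ← Finset.sum_sub_distrib]
  refine Finset.sum_congr rfl fun i _ => ?_
  rw [Finset.sum_div, ← hpd2 i i]
  have : ∀ j, aCoef u i j x * pd2 u i j x = (if i = j then pd2 u i j x else 0)
      - pd1 u i x * pd1 u j x * pd2 u i j x / (1 + ‖gradient u x‖ ^ 2) := by
    intro j
    rw [aCoef]
    split_ifs <;> ring
  simp_rw [this]
  rw [Finset.sum_sub_distrib]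
  simp

lemma hasDerivAt_line {E : Type*} [NormedAddCommGroup E] [NormedSpace ℝ E] (x v : E) (t : ℝ) :
    HasDerivAt (fun t : ℝ => x + t • v) v t := by
  simpa using ((hasDerivAt_id t).smul_const v).const_add x

/-- The Bernstein inequality at an interior maximum of the auxiliary function. -/
lemma bernstein_of_isLocalMax {n : ℕ} {θ : ℝ} {u : EuclideanSpace ℝ (Fin n) → ℝ}
    (hu1 : ContDiff ℝ 1 u)
    (hu3 : ContDiffOn ℝ 3 u {x | gradient u x ≠ 0})
    (heq : ∀ x : EuclideanSpace ℝ (Fin n), gradient u x ≠ 0 →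
      mcOp u x = Real.sqrt (1 + ‖gradient u x‖ ^ 2) *
        Real.log (1 + ‖gradient u x‖ ^ 2) ^ θ)
    {x₀ c : EuclideanSpace ℝ (Fin n)} {κ R : ℝ} (hR : 0 < R) (hx₀ : gradient u x₀ ≠ 0)
    (hs : 0 < 1 - ‖x₀ - c‖ ^ 2 / R ^ 2)
    (hmax : IsLocalMax (fun x => log (log (1 + ‖gradient u x‖ ^ 2)) - κ * u x
      + log (1 - ‖x - c‖ ^ 2 / R ^ 2)) x₀) :
    ∃ d : ℝ, |d| ≤ 2 / R * ‖gradient u x₀‖ ∧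
      2 * (√(1 + ‖gradient u x₀‖ ^ 2) * log (1 + ‖gradient u x₀‖ ^ 2) ^ θ) ^ 2
          / (n * (1 + ‖gradient u x₀‖ ^ 2) * log (1 + ‖gradient u x₀‖ ^ 2))
        + 2 * (log (1 + ‖gradient u x₀‖ ^ 2) ^ θ / (2 * √(1 + ‖gradient u x₀‖ ^ 2))
          + √(1 + ‖gradient u x₀‖ ^ 2) * (θ * log (1 + ‖gradient u x₀‖ ^ 2) ^ (θ - 1)
            / (1 + ‖gradient u x₀‖ ^ 2)))
          * (κ * ‖gradient u x₀‖ ^ 2 - d / (1 - ‖x₀ - c‖ ^ 2 / R ^ 2))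
        - κ * (√(1 + ‖gradient u x₀‖ ^ 2) * log (1 + ‖gradient u x₀‖ ^ 2) ^ θ) ≤
      2 * n / (R ^ 2 * (1 - ‖x₀ - c‖ ^ 2 / R ^ 2))
        + 12 / (R ^ 2 * (1 - ‖x₀ - c‖ ^ 2 / R ^ 2) ^ 2) + 2 * κ ^ 2 := by
  have hopen : IsOpen {x | gradient u x ≠ 0} := by
    have hc : Continuous (gradient u) :=
      (InnerProductSpace.toDual ℝ _).symm.continuous.comp (hu1.continuous_fderiv one_ne_zero)
    exact isOpen_ne_fun hc continuous_const
  have hC3 : ∀ x, gradient u x ≠ 0 → ContDiffAt ℝ 3 u x := fun x hx =>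
    hu3.contDiffAt (hopen.mem_nhds hx)
  have hu : ∀ x, HasFDerivAt u (fderiv ℝ u x) x := fun x =>
    (hu1.differentiable one_ne_zero x).hasFDerivAt
  have hu' : ∀ x, gradient u x ≠ 0 →
      HasFDerivAt (fderiv ℝ u) (fderiv ℝ (fderiv ℝ u) x) x := fun x hx =>
    (((hC3 x hx).fderiv_right (m := 2) (by norm_num)).differentiableAt two_ne_zero).hasFDerivAt
  have hu'' : HasFDerivAt (fderiv ℝ (fderiv ℝ u)) (fderiv ℝ (fderiv ℝ (fderiv ℝ u)) x₀) x₀ :=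
    ((((hC3 x₀ hx₀).fderiv_right (m := 2) (by norm_num)).fderiv_right (m := 1)
      (by norm_num)).differentiableAt one_ne_zero).hasFDerivAt
  have hUsymm : ∀ x, gradient u x ≠ 0 → ∀ v w,
      fderiv ℝ (fderiv ℝ u) x v w = fderiv ℝ (fderiv ℝ u) x w v := fun x hx v w =>
    (hC3 x hx).isSymmSndFDerivAt (by simp; norm_num) v w
  have hT12 : ∀ v w, fderiv ℝ (fderiv ℝ (fderiv ℝ u)) x₀ v w =
      fderiv ℝ (fderiv ℝ (fderiv ℝ u)) x₀ w v := fun v w =>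
    ((hC3 x₀ hx₀).fderiv_right (m := 2) (by norm_num)).isSymmSndFDerivAt (by simp) v w
  have hline : ∀ v : EuclideanSpace ℝ (Fin n), ∀ᶠ t : ℝ in nhds 0, gradient u (x₀ + t • v) ≠ 0 :=
    fun v => (hasDerivAt_line x₀ v 0).continuousAt.eventually
      (hopen.mem_nhds (by simpa using hx₀))
  have hd2 : ∀ v, HasDerivAt (fun t : ℝ => fderiv ℝ (fderiv ℝ u) (x₀ + t • v))
      (fderiv ℝ (fderiv ℝ (fderiv ℝ u)) x₀ v) 0 := fun v =>
    HasFDerivAt.comp_hasDerivAt (0 : ℝ) (l := fderiv ℝ (fderiv ℝ u)) (by simpa using hu'')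
      (hasDerivAt_line x₀ v 0)
  have hd1 : ∀ v (t : ℝ), gradient u (x₀ + t • v) ≠ 0 →
      HasDerivAt (fun t : ℝ => fderiv ℝ u (x₀ + t • v))
        (fderiv ℝ (fderiv ℝ u) (x₀ + t • v) v) t := fun v t ht =>
    HasFDerivAt.comp_hasDerivAt t (l := fderiv ℝ u) (hu' _ ht) (hasDerivAt_line x₀ v t)
  have hd0 : ∀ v (t : ℝ), HasDerivAt (fun t : ℝ => u (x₀ + t • v))
        (fderiv ℝ u (x₀ + t • v) v) t := fun v t =>
    HasFDerivAt.comp_hasDerivAt t (l := u) (hu _) (hasDerivAt_line x₀ v t)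
  have hT23 : ∀ a v w, fderiv ℝ (fderiv ℝ (fderiv ℝ u)) x₀ a v w =
      fderiv ℝ (fderiv ℝ (fderiv ℝ u)) x₀ a w v := by
    intro a v w
    have h1 := ((hd2 a).clm_apply (hasDerivAt_const 0 v)).clm_apply (hasDerivAt_const 0 w)
    have h2 := ((hd2 a).clm_apply (hasDerivAt_const 0 w)).clm_apply (hasDerivAt_const 0 v)
    have h3 := h1.unique (h2.congr_of_eventuallyEq ?_)
    · simpa using h3
    · filter_upwards [hline a] with t ht using hUsymm _ ht v w
  have hPe : ∀ (l : EuclideanSpace ℝ (Fin n) →L[ℝ] ℝ),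
      ∑ i, fderiv ℝ u x₀ (EuclideanSpace.single i 1) * l (EuclideanSpace.single i 1)
        = l (gradient u x₀) := by
    intro l
    conv_rhs => rw [← sum_coord_smul_single (gradient u x₀)]
    simp [gradient_coord]
  have hq : ∀ v : EuclideanSpace ℝ (Fin n), ∀ᶠ t : ℝ in nhds 0,
      HasDerivAt (fun t : ℝ => ‖gradient u (x₀ + t • v)‖ ^ 2)
        (∑ i, 2 * (fderiv ℝ u (x₀ + t • v) (EuclideanSpace.single i 1) *
          fderiv ℝ (fderiv ℝ u) (x₀ + t • v) v (EuclideanSpace.single i 1))) t := by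
    intro v
    filter_upwards [hline v] with t ht
    simp_rw [norm_gradient_sq]
    refine HasDerivAt.fun_sum fun i _ => ?_
    have h1 := ((hd1 v t ht).clm_apply (hasDerivAt_const t (EuclideanSpace.single i (1 : ℝ)))).pow 2
    refine h1.congr_deriv ?_
    simp
    ring
  have hq' : ∀ v : EuclideanSpace ℝ (Fin n),
      HasDerivAt (fun t : ℝ => ∑ i, 2 * (fderiv ℝ u (x₀ + t • v) (EuclideanSpace.single i 1) *
          fderiv ℝ (fderiv ℝ u) (x₀ + t • v) v (EuclideanSpace.single i 1)))
        (2 * ∑ i, (fderiv ℝ (fderiv ℝ u) x₀ v (EuclideanSpace.single i 1)) ^ 2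
          + 2 * fderiv ℝ (fderiv ℝ (fderiv ℝ u)) x₀ v v (gradient u x₀)) 0 := by
    intro v
    rw [← hPe, ← mul_add, ← Finset.sum_add_distrib, Finset.mul_sum]
    refine HasDerivAt.fun_sum fun i _ => ?_
    have h1 := ((hd1 v 0 (hline v).self_of_nhds).clm_apply
      (hasDerivAt_const (0 : ℝ) (EuclideanSpace.single i (1 : ℝ)))).mul
      (((hd2 v).clm_apply (hasDerivAt_const (0 : ℝ) v)).clm_apply
        (hasDerivAt_const (0 : ℝ) (EuclideanSpace.single i (1 : ℝ))))
    refine (h1.const_mul 2).congr_deriv ?_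
    simp
    ring
  have ha' : ∀ v : EuclideanSpace ℝ (Fin n),
      HasDerivAt (fun t : ℝ => fderiv ℝ u (x₀ + t • v) v) (fderiv ℝ (fderiv ℝ u) x₀ v v) 0 := by
    intro v
    refine ((hd1 v 0 (hline v).self_of_nhds).clm_apply (hasDerivAt_const (0 : ℝ) v)).congr_deriv ?_
    simp
  have hsd : ∀ (v : EuclideanSpace ℝ (Fin n)) (t : ℝ),
      HasDerivAt (fun t : ℝ => 1 - ‖x₀ + t • v - c‖ ^ 2 / R ^ 2)
        (-2 / R ^ 2 * inner ℝ (x₀ + t • v - c) v) t := by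
    intro v t
    have h1 := (((hasDerivAt_line x₀ v t).sub_const c).norm_sq.div_const (R ^ 2)).const_sub 1
    refine h1.congr_deriv ?_
    ring
  have hsd' : ∀ v : EuclideanSpace ℝ (Fin n),
      HasDerivAt (fun t : ℝ => -2 / R ^ 2 * inner ℝ (x₀ + t • v - c) v)
        (-2 * ‖v‖ ^ 2 / R ^ 2) 0 := by
    intro v
    have h1 := (((hasDerivAt_line x₀ v 0).sub_const c).inner ℝ
      (hasDerivAt_const (0 : ℝ) v)).const_mul (-2 / R ^ 2)
    refine h1.congr_deriv ?_
    simp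
    ring
  have hq0 : 0 < ‖gradient u x₀‖ ^ 2 := by
    have := norm_pos_iff.2 hx₀
    positivity
  have hcond := fun v : EuclideanSpace ℝ (Fin n) =>
    order_conditions_of_isLocalMax (κ := κ) (hq v) (hq' v) (Eventually.of_forall (hd0 v)) (ha' v)
      (Eventually.of_forall (hsd v)) (hsd' v) (by simpa using hq0) (by simpa using hs) (by
        have h1 : Tendsto (fun t : ℝ => x₀ + t • v) (nhds 0) (nhds x₀) := by
          simpa using (hasDerivAt_line x₀ v 0).continuousAt.tendsto
        have h2 := h1.eventually hmax
        filter_upwards [h2] with t ht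
        simpa using ht)
  simp only [zero_smul, add_zero, ← Finset.mul_sum, hPe] at hcond
  have hE := heq x₀ hx₀
  rw [mcOp_eq (hu' x₀ hx₀).differentiableAt] at hE
  have hGd : HasDerivAt (fun t : ℝ => gradient u (x₀ + t • gradient u x₀))
      (∑ i, fderiv ℝ (fderiv ℝ u) x₀ (gradient u x₀) (EuclideanSpace.single i 1) •
        EuclideanSpace.single i (1 : ℝ)) 0 := by
    have h0 : (fun t : ℝ => gradient u (x₀ + t • gradient u x₀)) = fun t : ℝ =>
        ∑ i, fderiv ℝ u (x₀ + t • gradient u x₀) (EuclideanSpace.single i 1) •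
          EuclideanSpace.single i (1 : ℝ) := by
      funext t
      conv_lhs => rw [← sum_coord_smul_single (gradient u (x₀ + t • gradient u x₀))]
      simp_rw [gradient_coord]
    rw [h0]
    refine HasDerivAt.fun_sum fun i _ => ?_
    refine HasDerivAt.smul_const ?_ _
    refine ((hd1 (gradient u x₀) 0 (hline _).self_of_nhds).clm_apply
      (hasDerivAt_const (0 : ℝ) (EuclideanSpace.single i (1 : ℝ)))).congr_deriv ?_
    simp
  have hqP := (hq (gradient u x₀)).self_of_nhds
  simp only [zero_smul, add_zero, ← Finset.mul_sum, hPe] at hqP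
  have hpos : 0 < 1 + ‖gradient u x₀‖ ^ 2 := by positivity
  have hLpos : 0 < log (1 + ‖gradient u x₀‖ ^ 2) := log_pos (by linarith)
  have hE' : ∑ k, fderiv ℝ (fderiv ℝ (fderiv ℝ u)) x₀ (gradient u x₀)
        (EuclideanSpace.single k 1) (EuclideanSpace.single k 1)
      - fderiv ℝ (fderiv ℝ (fderiv ℝ u)) x₀ (gradient u x₀) (gradient u x₀) (gradient u x₀)
        / (1 + ‖gradient u x₀‖ ^ 2)
      - 2 * ∑ i, (fderiv ℝ (fderiv ℝ u) x₀ (gradient u x₀) (EuclideanSpace.single i 1)) ^ 2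
        / (1 + ‖gradient u x₀‖ ^ 2)
      + 2 * (fderiv ℝ (fderiv ℝ u) x₀ (gradient u x₀) (gradient u x₀)) ^ 2
        / (1 + ‖gradient u x₀‖ ^ 2) ^ 2 =
      (log (1 + ‖gradient u x₀‖ ^ 2) ^ θ / (2 * √(1 + ‖gradient u x₀‖ ^ 2))
          + √(1 + ‖gradient u x₀‖ ^ 2) * (θ * log (1 + ‖gradient u x₀‖ ^ 2) ^ (θ - 1)
            / (1 + ‖gradient u x₀‖ ^ 2))) *
        (2 * fderiv ℝ (fderiv ℝ u) x₀ (gradient u x₀) (gradient u x₀)) := by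
    have hq1 := hqP.const_add 1
    have hr := (hq1.sqrt (by simpa using hpos.ne')).mul
      ((hq1.log (by simpa using hpos.ne')).rpow_const (p := θ) (Or.inl (by simpa using hLpos.ne')))
    have hl := (HasDerivAt.fun_sum fun k (_ : k ∈ Finset.univ) =>
      ((hd2 (gradient u x₀)).clm_apply
        (hasDerivAt_const (0 : ℝ) (EuclideanSpace.single (k : Fin n) (1 : ℝ)))).clm_apply
        (hasDerivAt_const (0 : ℝ) (EuclideanSpace.single k (1 : ℝ)))).sub
      ((((hd2 (gradient u x₀)).clm_apply hGd).clm_apply hGd).div hq1 (by simpa using hpos.ne'))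
    have huniq := hl.unique (hr.congr_of_eventuallyEq ?_)
    · have hw : ∀ β : EuclideanSpace ℝ (Fin n) →L[ℝ] ℝ,
          β (∑ i, fderiv ℝ (fderiv ℝ u) x₀ (gradient u x₀) (EuclideanSpace.single i 1) •
            EuclideanSpace.single i (1 : ℝ)) = ∑ i,
            fderiv ℝ (fderiv ℝ u) x₀ (gradient u x₀) (EuclideanSpace.single i 1) *
            β (EuclideanSpace.single i (1 : ℝ)) := by
        intro β; simp
      simp only [zero_smul, add_zero, map_zero, add_apply, hw] at huniq
      rw [hUsymm x₀ hx₀ (∑ i, fderiv ℝ (fderiv ℝ u) x₀ (gradient u x₀) (EuclideanSpace.single i 1) •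
            EuclideanSpace.single i (1 : ℝ)), hw] at huniq
      simp only [← sq] at huniq
      rw [← Finset.sum_div]
      refine Eq.trans ?_ (huniq.trans ?_)
      · clear * - hpos
        field_simp
        ring
      · ring
    · filter_upwards [hline (gradient u x₀)] with t ht
      have := heq _ ht
      rw [mcOp_eq (hu' _ ht).differentiableAt] at this
      simpa using this
  have hxR : ‖x₀ - c‖ ≤ R := by
    rw [sub_pos, div_lt_one (by positivity)] at hs
    exact (lt_of_pow_lt_pow_left₀ 2 hR.le hs).le
  refine ⟨((-2 / R ^ 2) • innerSL ℝ (x₀ - c)) (gradient u x₀), ?_, ?_⟩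
  · rw [smul_apply, innerSL_apply_apply, smul_eq_mul, abs_mul, abs_div, abs_neg, abs_two,
      abs_of_pos (by positivity : 0 < R ^ 2)]
    calc 2 / R ^ 2 * |inner ℝ (x₀ - c) (gradient u x₀)|
        ≤ 2 / R ^ 2 * (R * ‖gradient u x₀‖) := by
          gcongr
          exact (abs_real_inner_le_norm _ _).trans (by gcongr)
      _ = 2 / R * ‖gradient u x₀‖ := by field_simp
  · refine bernstein_jet (gradient u x₀) (fderiv ℝ (fderiv ℝ u) x₀)
      (fderiv ℝ (fderiv ℝ (fderiv ℝ u)) x₀) ((-2 / R ^ 2) • innerSL ℝ (x₀ - c)) hLpos hs hR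
      (hUsymm x₀ hx₀) (fun v => ?_) hE hE' (fun v => ?_) (fun v => ?_) ?_
    · rw [hT23, hT12]
    · refine Eq.trans ?_ (hcond v).1
      simp [inner_gradient_left, inner_sub_left]
    · refine le_of_eq_of_le ?_ (hcond v).2
      simp [inner_sub_left]
    · calc ∑ i, (((-2 / R ^ 2) • innerSL ℝ (x₀ - c) :
            EuclideanSpace ℝ (Fin n) →L[ℝ] ℝ) (EuclideanSpace.single i 1)) ^ 2
          = 4 / (R ^ 2) ^ 2 * ‖x₀ - c‖ ^ 2 := by
            rw [EuclideanSpace.norm_sq_eq, Finset.mul_sum]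
            refine Finset.sum_congr rfl fun i _ => ?_
            rw [smul_apply, innerSL_apply_apply, EuclideanSpace.inner_single_right]
            simp only [smul_eq_mul, one_mul, conj_trivial, norm_eq_abs, sq_abs]
            ring
        _ ≤ 4 / (R ^ 2) ^ 2 * R ^ 2 := by gcongr
        _ = 4 / R ^ 2 := by field_simp

/-- The lower-order terms of the Bernstein inequality are cubic in the logarithm. -/
lemma scalar_bernstein_error {N A R L : ℝ} (hN : 0 < N) (hA : 0 < A) (hR : 0 < R) (hL : 0 < L) :
    4 / R + (L + 2) * (2 / R) * (L / A) +
      (2 * N * (1 / R) * (L / A) + 12 * (1 / R) * (L / A) ^ 2 + 2 * (1 / R)) * (1 + L) ≤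
      (6 + 4 / A + 2 * N / A + 12 / A ^ 2) * (1 + L) ^ 3 / R := by
  have e4 : 4 / R + (L + 2) * (2 / R) * (L / A) +
    (2 * N * (1 / R) * (L / A) + 12 * (1 / R) * (L / A) ^ 2 + 2 * (1 / R)) * (1 + L) =
    (4 + 2 * (1 + L) + (4 / A) * ((L + 2) * L / 2) + (2 * N / A) * (L * (1 + L))
      + (12 / A ^ 2) * (L ^ 2 * (1 + L))) / R := by
    field_simp
    ring
  rw [e4]
  have hL2 := pow_pos hL 2
  have hL3 := pow_pos hL 3
  have hexp : (1 + L) ^ 3 = 1 + 3 * L + 3 * L ^ 2 + L ^ 3 := by ring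
  have p0 : 4 + 2 * (1 + L) ≤ 6 * (1 + L) ^ 3 := by linarith
  have p1 : (L + 2) * L / 2 ≤ (1 + L) ^ 3 := by linarith
  have p2 : L * (1 + L) ≤ (1 + L) ^ 3 := by linarith
  have p3 : L ^ 2 * (1 + L) ≤ (1 + L) ^ 3 := by linarith
  calc (4 + 2 * (1 + L) + (4 / A) * ((L + 2) * L / 2) + (2 * N / A) * (L * (1 + L))
      + (12 / A ^ 2) * (L ^ 2 * (1 + L))) / R ≤ (6 * (1 + L) ^ 3 + (4 / A) * (1 + L) ^ 3
        + (2 * N / A) * (1 + L) ^ 3 + (12 / A ^ 2) * (1 + L) ^ 3) / R := by gcongr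
    _ = _ := by ring

/-- The scalar form of the Bernstein inequality with `κ = R⁻²`, after normalisation. -/
lemma scalar_bernstein {N θ q d s A R : ℝ} (hN : 0 < N) (hθ₀ : 0 < θ) (hθ₁ : θ ≤ 1)
    (hq : 0 < q) (hs : 0 < s) (hs1 : s ≤ 1) (hA : 0 < A) (hR : 1 ≤ R)
    (hAL : A ≤ log (1 + q) * s) (hd : |d| ≤ 2 / R * √q)
    (h : 2 * (√(1 + q) * log (1 + q) ^ θ) ^ 2 / (N * (1 + q) * log (1 + q))
        + 2 * (log (1 + q) ^ θ / (2 * √(1 + q))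
          + √(1 + q) * (θ * log (1 + q) ^ (θ - 1) / (1 + q))) * (1 / R ^ 2 * q - d / s)
        - 1 / R ^ 2 * (√(1 + q) * log (1 + q) ^ θ) ≤
      2 * N / (R ^ 2 * s) + 12 / (R ^ 2 * s ^ 2) + 2 * (1 / R ^ 2) ^ 2) :
    2 * A ^ θ / N + 2 * θ * exp (log (1 + q) / 2) / R ^ 2 ≤
      (6 + 4 / A + 2 * N / A + 12 / A ^ 2) * (1 + log (1 + q)) ^ 3 / R := by
  have hW : exp (log (1 + q) / 2) = √(1 + q) := by
    rw [← log_sqrt (by positivity), exp_log (by positivity)]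
  have hW2 : √(1 + q) ^ 2 = 1 + q := sq_sqrt (by positivity)
  have hW1 : 1 ≤ √(1 + q) := one_le_sqrt.2 (by linarith)
  have hqW : √q ≤ √(1 + q) := sqrt_le_sqrt (by linarith)
  have hL : 0 < log (1 + q) := log_pos (by linarith)
  have hLW : log (1 + q) ≤ 2 * √(1 + q) := by
    have := log_le_self (sqrt_nonneg (1 + q))
    rw [log_sqrt (by positivity)] at this
    linarith
  rw [hW]
  have hLA : A ≤ log (1 + q) := hAL.trans (mul_le_of_le_one_right hL.le hs1)
  have hXA : A ^ θ ≤ log (1 + q) ^ θ := rpow_le_rpow hA.le hLA hθ₀.le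
  have hY : log (1 + q) ^ (θ - 1) = log (1 + q) ^ θ / log (1 + q) := by
    rw [rpow_sub hL, rpow_one]
  have hLX : log (1 + q) / log (1 + q) ^ θ ≤ 1 + log (1 + q) := by
    have : log (1 + q) / log (1 + q) ^ θ = log (1 + q) ^ (1 - θ) := by
      rw [rpow_sub hL, rpow_one]
    rw [this]
    calc log (1 + q) ^ (1 - θ) ≤ (1 + log (1 + q)) ^ (1 - θ) :=
          rpow_le_rpow hL.le (by linarith) (by linarith)
      _ ≤ (1 + log (1 + q)) ^ (1 : ℝ) := rpow_le_rpow_of_exponent_le (by linarith) (by linarith)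
      _ = _ := rpow_one _
  rw [hY] at h
  have hX : 0 < log (1 + q) ^ θ := rpow_pos_of_pos hL θ
  generalize log (1 + q) ^ θ = X at *
  generalize log (1 + q) = L at *
  generalize √(1 + q) = W at *
  have hqe : q = W ^ 2 - 1 := by linarith
  have hWpos : 0 < W := by linarith
  have hR0 : 0 < R := by linarith
  have hsL : 1 / s ≤ L / A := by rw [div_le_div_iff₀ hs hA]; linarith
  have hdW : d ≤ 2 / R * W := (le_abs_self d).trans (hd.trans (by gcongr))
  have h1 := mul_le_mul_of_nonneg_right h (by positivity : 0 ≤ L / X)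
  have e1 : (2 * (W * X) ^ 2 / (N * (1 + q) * L) + 2 * (X / (2 * W) + W * (θ * (X / L) / (1 + q)))
      * (1 / R ^ 2 * q - d / s) - 1 / R ^ 2 * (W * X)) * (L / X) =
      2 * X / N + 2 * θ * W / R ^ 2 - (2 * θ + L) / W / R ^ 2 - (L + 2 * θ) * (d / W) * (1 / s) := by
    rw [← hW2, hqe]
    field_simp
    ring
  rw [e1] at h1
  have b1 : (2 * θ + L) / W ≤ 4 := by
    rw [div_le_iff₀ hWpos]
    linarith
  have hRR : 1 / R ^ 2 ≤ 1 / R := by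
    exact one_div_le_one_div_of_le hR0 (le_self_pow₀ hR two_ne_zero)
  have b2 : (2 * θ + L) / W / R ^ 2 ≤ 4 / R := by
    calc (2 * θ + L) / W / R ^ 2 ≤ 4 * (1 / R ^ 2) := by rw [div_eq_mul_one_div]; gcongr
      _ ≤ 4 * (1 / R) := by gcongr
      _ = _ := by ring
  have hdW' : d / W ≤ 2 / R := by rw [div_le_iff₀ hWpos]; exact hdW
  have b3 : (L + 2 * θ) * (d / W) * (1 / s) ≤ (L + 2) * (2 / R) * (L / A) := by
    calc (L + 2 * θ) * (d / W) * (1 / s) ≤ (L + 2 * θ) * (2 / R) * (1 / s) := by gcongr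
      _ ≤ (L + 2) * (2 / R) * (L / A) := by gcongr; linarith
  have hR3 : (1 / R ^ 2) ^ 2 ≤ 1 / R := by
    have h5 : 1 / R ^ 2 ≤ 1 := by
      rw [div_le_one (by positivity)]
      exact one_le_pow₀ hR
    have h6 : 0 ≤ 1 / R ^ 2 := by positivity
    rw [sq]
    exact (mul_le_of_le_one_left h6 h5).trans hRR
  have b4 : (2 * N / (R ^ 2 * s) + 12 / (R ^ 2 * s ^ 2) + 2 * (1 / R ^ 2) ^ 2) * (L / X) ≤
      (2 * N * (1 / R) * (L / A) + 12 * (1 / R) * (L / A) ^ 2 + 2 * (1 / R)) * (1 + L) := by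
    have e2 : 2 * N / (R ^ 2 * s) = 2 * N * (1 / R ^ 2) * (1 / s) := by field_simp
    have e3 : 12 / (R ^ 2 * s ^ 2) = 12 * (1 / R ^ 2) * (1 / s) ^ 2 := by field_simp
    rw [e2, e3]
    gcongr
  have b5 : 2 * A ^ θ / N ≤ 2 * X / N := by gcongr
  have b6 := scalar_bernstein_error hN hA hR0 hL
  linarith

/-- The exponential beats the cubic, uniformly in `L`, once `R` is large. -/
lemma exists_forall_lt_exp_add {a b K : ℝ} (ha : 0 < a) (hb : 0 < b) (hK : 0 < K) :
    ∃ R₀ : ℝ, ∀ R, 1 ≤ R → R₀ ≤ R → ∀ L, 0 ≤ L →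
      K * (1 + L) ^ 3 / R < a + b * exp (L / 2) / R ^ 2 := by
  set M := K ^ 2 * (5040 * 128 * exp (1 / 2)) / (4 * a * b) with hM
  refine ⟨K * M ^ 3 / a + 1, fun R hR1 hR L hL => ?_⟩
  by_contra! hcon
  have hR0 : 0 < R := by linarith
  have h7 : ((1 + L) / 2) ^ 7 / 5040 ≤ exp ((1 + L) / 2) := by
    have := pow_div_factorial_le_exp ((1 + L) / 2) (by positivity) 7
    norm_num [Nat.factorial] at this ⊢
    linarith
  have hE : exp ((1 + L) / 2) = exp (1 / 2) * exp (L / 2) := by rw [← exp_add]; ring_nf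
  rw [hE] at h7
  set E := exp (L / 2)
  have hEpos : 0 < E := exp_pos _
  have h1 : 4 * a * b * E / R ^ 2 ≤ K ^ 2 * (1 + L) ^ 6 / R ^ 2 := by
    calc 4 * a * b * E / R ^ 2 ≤ (a + b * E / R ^ 2) ^ 2 := by
          have : 4 * a * b * E / R ^ 2 = 4 * a * (b * E / R ^ 2) := by ring
          rw [this]
          nlinarith [sq_nonneg (a - b * E / R ^ 2)]
      _ ≤ (K * (1 + L) ^ 3 / R) ^ 2 := by gcongr
      _ = _ := by ring
  rw [div_le_div_iff_of_pos_right (by positivity)] at h1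
  have h2 : 1 + L ≤ M := by
    rw [hM, le_div_iff₀ (by positivity)]
    have h3 : (1 + L) ^ 7 ≤ 5040 * 128 * exp (1 / 2) * E := by
      have : ((1 + L) / 2) ^ 7 / 5040 = (1 + L) ^ 7 / (5040 * 128) := by ring
      rw [this, div_le_iff₀ (by positivity)] at h7
      linarith
    have h4 : (1 + L) ^ 6 * ((1 + L) * (4 * a * b)) ≤
        (1 + L) ^ 6 * (K ^ 2 * (5040 * 128 * exp (1 / 2))) := by
      calc (1 + L) ^ 6 * ((1 + L) * (4 * a * b)) = 4 * a * b * (1 + L) ^ 7 := by ring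
        _ ≤ 4 * a * b * (5040 * 128 * exp (1 / 2) * E) := by gcongr
        _ = 5040 * 128 * exp (1 / 2) * (4 * a * b * E) := by ring
        _ ≤ 5040 * 128 * exp (1 / 2) * (K ^ 2 * (1 + L) ^ 6) := by gcongr
        _ = _ := by ring
    exact le_of_mul_le_mul_left h4 (by positivity)
  have h5 : a ≤ K * M ^ 3 / R := by
    calc a ≤ a + b * E / R ^ 2 := by
          have : 0 ≤ b * E / R ^ 2 := by positivity
          linarith
      _ ≤ K * (1 + L) ^ 3 / R := hcon
      _ ≤ K * M ^ 3 / R := by gcongr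
  rw [le_div_iff₀ hR0] at h5
  have h6 : K * M ^ 3 / a + 1 ≤ R := hR
  have h8 : R ≤ K * M ^ 3 / a := by rw [le_div_iff₀ ha]; linarith
  linarith

/-- Subquadratic growth bounds `u` by `R²` on large balls about any centre. -/
lemma eventually_abs_le_sq_on_closedBall {n : ℕ} {u : EuclideanSpace ℝ (Fin n) → ℝ}
    (hu : Continuous u)
    (hgrowth : Filter.Tendsto (fun x : EuclideanSpace ℝ (Fin n) => |u x| / ‖x‖ ^ 2)
      (Filter.cocompact _) (nhds 0)) (c : EuclideanSpace ℝ (Fin n)) :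
    ∃ R₀ : ℝ, ∀ R, 1 ≤ R → R₀ ≤ R → ∀ x ∈ closedBall c R, |u x| ≤ R ^ 2 := by
  have h1 : ∀ᶠ x in Filter.cocompact (EuclideanSpace ℝ (Fin n)), |u x| / ‖x‖ ^ 2 < 1 / 4 :=
    hgrowth.eventually (gt_mem_nhds (by norm_num))
  obtain ⟨K, hK, hKs⟩ := Filter.mem_cocompact.1 h1
  obtain ⟨M, hM⟩ := hK.exists_bound_of_continuousOn hu.continuousOn
  refine ⟨max M (max ‖c‖ |u 0|), fun R hR1 hR x hx => ?_⟩
  have hRM : M ≤ R := (le_max_left _ _).trans hR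
  have hRc : ‖c‖ ≤ R := ((le_max_left _ _).trans (le_max_right _ _)).trans hR
  have hRu : |u 0| ≤ R := ((le_max_right _ _).trans (le_max_right _ _)).trans hR
  by_cases hxK : x ∈ K
  · have := hM x hxK
    rw [norm_eq_abs] at this
    nlinarith
  · rcases eq_or_ne x 0 with rfl | hx0
    · nlinarith
    have h2 : |u x| / ‖x‖ ^ 2 < 1 / 4 := hKs hxK
    have hxpos : 0 < ‖x‖ := norm_pos_iff.2 hx0
    rw [div_lt_iff₀ (by positivity)] at h2
    have h3 : ‖x‖ ≤ 2 * R := by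
      have := norm_le_norm_add_norm_sub' x c
      rw [mem_closedBall, dist_eq_norm] at hx
      linarith
    nlinarith

/-- Liouville theorem (E3): entire solutions of
`div(∇u/√(1+|∇u|²)) = log^θ(1+|∇u|²)`, `0 < θ ≤ 1`, growing like `o(|x|²)`,
are constant. -/
theorem liouville_E3 (n : ℕ) (hn : 1 ≤ n) (θ : ℝ) (hθ₀ : 0 < θ) (hθ₁ : θ ≤ 1)
    (u : EuclideanSpace ℝ (Fin n) → ℝ)
    (hu1 : ContDiff ℝ 1 u)
    (hu3 : ContDiffOn ℝ 3 u {x | gradient u x ≠ 0})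
    (heq : ∀ x : EuclideanSpace ℝ (Fin n), gradient u x ≠ 0 →
      mcOp u x = Real.sqrt (1 + ‖gradient u x‖ ^ 2) *
        Real.log (1 + ‖gradient u x‖ ^ 2) ^ θ)
    (hgrowth : Filter.Tendsto (fun x : EuclideanSpace ℝ (Fin n) => |u x| / ‖x‖ ^ 2)
      (Filter.cocompact _) (nhds 0)) :
    ∃ c : ℝ, ∀ x, u x = c := by
  suffices hgrad : ∀ c, gradient u c = 0 by
    refine ⟨u 0, fun x => is_const_of_fderiv_eq_zero (hu1.differentiable one_ne_zero)
      (fun y => ?_) x 0⟩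
    ext v
    rw [← inner_gradient_left, hgrad y]
    simp
  intro c
  by_contra hc
  have hnpos : (0 : ℝ) < n := by exact_mod_cast hn
  have hLc : 0 < log (1 + ‖gradient u c‖ ^ 2) := by
    have hnorm := norm_pos_iff.2 hc
    have : 0 < ‖gradient u c‖ ^ 2 := by positivity
    exact log_pos (by linarith)
  set A := log (1 + ‖gradient u c‖ ^ 2) * exp (-2) with hAdef
  have hA : 0 < A := by positivity
  obtain ⟨R₁, hR₁⟩ := eventually_abs_le_sq_on_closedBall hu1.continuous hgrowth c
  obtain ⟨R₂, hR₂⟩ := exists_forall_lt_exp_add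
    (a := 2 * A ^ θ / n) (b := 2 * θ) (K := 6 + 4 / A + 2 * n / A + 12 / A ^ 2)
    (by positivity) (by positivity) (by positivity)
  set R := max 1 (max R₁ R₂) with hRdef
  have hR1 : 1 ≤ R := le_max_left _ _
  have hRR₁ : R₁ ≤ R := (le_max_left _ _).trans (le_max_right _ _)
  have hRR₂ : R₂ ≤ R := (le_max_right _ _).trans (le_max_right _ _)
  clear_value R
  have hR0 : 0 < R := by linarith
  have hub := hR₁ R hR1 hRR₁
  have hgc : Continuous (gradient u) :=
    (InnerProductSpace.toDual ℝ _).symm.continuous.comp (hu1.continuous_fderiv one_ne_zero)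
  have hLcont : Continuous fun x => log (1 + ‖gradient u x‖ ^ 2) :=
    Continuous.log (f := fun x => 1 + ‖gradient u x‖ ^ 2) (by fun_prop) fun x =>
      (by positivity : (0 : ℝ) < 1 + ‖gradient u x‖ ^ 2).ne'
  have hucont := hu1.continuous
  have hGcont : Continuous fun x => log (1 + ‖gradient u x‖ ^ 2) * exp (-(1 / R ^ 2 * u x)) *
      (1 - ‖x - c‖ ^ 2 / R ^ 2) := by fun_prop
  obtain ⟨x₀, hx₀, hmax⟩ := (isCompact_closedBall c R).exists_isMaxOn
    ⟨c, mem_closedBall_self hR0.le⟩ hGcont.continuousOn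
  have hGc := hmax (mem_closedBall_self hR0.le)
  simp only [Set.mem_ofPred_eq, sub_self, norm_zero, ne_eq, OfNat.ofNat_ne_zero, not_false_eq_true,
    zero_pow, zero_div, sub_zero, mul_one] at hGc
  have hGpos : 0 < log (1 + ‖gradient u x₀‖ ^ 2) * exp (-(1 / R ^ 2 * u x₀)) *
      (1 - ‖x₀ - c‖ ^ 2 / R ^ 2) := lt_of_lt_of_le (by positivity) hGc
  have hL0 : 0 ≤ log (1 + ‖gradient u x₀‖ ^ 2) := log_nonneg (by simp)
  have hs : 0 < 1 - ‖x₀ - c‖ ^ 2 / R ^ 2 := pos_of_mul_pos_right hGpos (by positivity)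
  have hL : 0 < log (1 + ‖gradient u x₀‖ ^ 2) := by
    refine lt_of_le_of_ne hL0 fun h => ?_
    rw [← h] at hGpos
    simp at hGpos
  have hg0 : gradient u x₀ ≠ 0 := by
    rintro h
    simp [h] at hL
  have hs1 : 1 - ‖x₀ - c‖ ^ 2 / R ^ 2 ≤ 1 := by
    have : 0 ≤ ‖x₀ - c‖ ^ 2 / R ^ 2 := by positivity
    linarith
  have hκ : ∀ x ∈ closedBall c R, |1 / R ^ 2 * u x| ≤ 1 := by
    intro x hx
    rw [abs_mul, abs_of_pos (by positivity : 0 < 1 / R ^ 2), one_div, inv_mul_le_iff₀ (by positivity)]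
    simpa using hub x hx
  have hAL : A ≤ log (1 + ‖gradient u x₀‖ ^ 2) * (1 - ‖x₀ - c‖ ^ 2 / R ^ 2) := by
    have h1 := (abs_le.1 (hκ x₀ hx₀)).1
    have h2 := (abs_le.1 (hκ c (mem_closedBall_self hR0.le))).2
    have h3 : exp (-1) ≤ exp (-(1 / R ^ 2 * u c)) := exp_le_exp.2 (by linarith)
    have h4 : exp (-(1 / R ^ 2 * u x₀)) ≤ exp 1 := exp_le_exp.2 (by linarith)
    have h5 : log (1 + ‖gradient u c‖ ^ 2) * exp (-1) ≤
        log (1 + ‖gradient u x₀‖ ^ 2) * (1 - ‖x₀ - c‖ ^ 2 / R ^ 2) * exp 1 := by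
      calc _ ≤ log (1 + ‖gradient u c‖ ^ 2) * exp (-(1 / R ^ 2 * u c)) := by gcongr
        _ ≤ _ := hGc
        _ ≤ log (1 + ‖gradient u x₀‖ ^ 2) * exp 1 * (1 - ‖x₀ - c‖ ^ 2 / R ^ 2) := by gcongr
        _ = _ := by ring
    have h6 := mul_le_mul_of_nonneg_right h5 (exp_pos (-1)).le
    rw [mul_assoc, mul_assoc _ (exp 1), ← exp_add, ← exp_add] at h6
    norm_num at h6
    exact h6
  have hball : ∀ᶠ x in nhds x₀, x ∈ closedBall c R ∧ 0 < 1 - ‖x - c‖ ^ 2 / R ^ 2 := by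
    have h1 : ∀ᶠ x in nhds x₀, 0 < 1 - ‖x - c‖ ^ 2 / R ^ 2 :=
      (by fun_prop : Continuous fun x => 1 - ‖x - c‖ ^ 2 / R ^ 2).continuousAt.eventually
        (lt_mem_nhds hs)
    filter_upwards [h1] with x hx
    refine ⟨?_, hx⟩
    rw [sub_pos, div_lt_one (by positivity)] at hx
    rw [mem_closedBall, dist_eq_norm]
    exact (lt_of_pow_lt_pow_left₀ 2 hR0.le hx).le
  have hlocmax : IsLocalMax (fun x => log (log (1 + ‖gradient u x‖ ^ 2)) - 1 / R ^ 2 * u x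
      + log (1 - ‖x - c‖ ^ 2 / R ^ 2)) x₀ := by
    have hlogG : ∀ x, 0 < log (1 + ‖gradient u x‖ ^ 2) → 0 < 1 - ‖x - c‖ ^ 2 / R ^ 2 →
        log (log (1 + ‖gradient u x‖ ^ 2) * exp (-(1 / R ^ 2 * u x)) *
          (1 - ‖x - c‖ ^ 2 / R ^ 2)) = log (log (1 + ‖gradient u x‖ ^ 2)) - 1 / R ^ 2 * u x
            + log (1 - ‖x - c‖ ^ 2 / R ^ 2) := by
      intro x h1 h2
      rw [log_mul (by positivity) h2.ne', log_mul h1.ne' (exp_pos _).ne', log_exp]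
      ring
    filter_upwards [hball, hLcont.continuousAt.eventually (lt_mem_nhds hL)] with x hx hLx
    rw [← hlogG x hLx hx.2, ← hlogG x₀ hL hs]
    exact log_le_log (by have := hx.2; positivity) (hmax hx.1)
  obtain ⟨d, hd, hB⟩ := bernstein_of_isLocalMax hu1 hu3 heq hR0 hg0 hs hlocmax
  have hq : 0 < ‖gradient u x₀‖ ^ 2 := by
    have := norm_pos_iff.2 hg0
    positivity
  have := scalar_bernstein hnpos hθ₀ hθ₁ hq hs hs1 hA hR1 hAL
    (by rwa [sqrt_sq (norm_nonneg _)]) hB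
  exact absurd this (not_le.2 (hR₂ R hR1 hRR₂ _ hL.le))
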